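/- Let k be an algebraically closed field, let a, b, c, d, e, B, C, E ∈ k with E ≠ 0, and let T = T(a,b,c,d,e,1; 0,B,C,0,E,0). Suppose the family (i,j,l) ↦ y^i·x^j·z^l (for i, j, l ≥ 0) is a k-vector-space basis of T. Then: (1) y is normal in T, i.e., the set {y·t : t ∈ T} equals the set {t·y : t ∈ T}; and (2) for all n ≥ 1, f_n ≠ 0, where f_n ∈ k is computed from the pair (a,d). In particular a ≠ 1. -/

import Mathlib

noncomputable section

open FreeAlgebra

/-- The generator `x` of the free algebra `k⟨x,y,z⟩`. -/
def Xf (k : Type*) [Field k] : FreeAlgebra k (Fin 3) := FreeAlgebra.ι k 0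

/-- The generator `y` of the free algebra `k⟨x,y,z⟩`. -/
def Yf (k : Type*) [Field k] : FreeAlgebra k (Fin 3) := FreeAlgebra.ι k 1

/-- The generator `z` of the free algebra `k⟨x,y,z⟩`. -/
def Zf (k : Type*) [Field k] : FreeAlgebra k (Fin 3) := FreeAlgebra.ι k 2

/-- The relations defining `T(a,b,c,d,e,f; A,B,C,D,E,F)`: `xy = yx`,
`zx = a·x² + b·xy + c·y² + d·xz + e·yz + f·z²`, and
`zy = A·x² + B·xy + C·y² + D·xz + E·yz + F·z²`. -/
def Trel (k : Type*) [Field k] (a b c d e f A B C D E F : k) :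
    FreeAlgebra k (Fin 3) → FreeAlgebra k (Fin 3) → Prop := fun m n =>
  (m = Xf k * Yf k ∧ n = Yf k * Xf k) ∨
  (m = Zf k * Xf k ∧
    n = a • (Xf k) ^ 2 + b • (Xf k * Yf k) + c • (Yf k) ^ 2 +
        d • (Xf k * Zf k) + e • (Yf k * Zf k) + f • (Zf k) ^ 2) ∨
  (m = Zf k * Yf k ∧
    n = A • (Xf k) ^ 2 + B • (Xf k * Yf k) + C • (Yf k) ^ 2 +
        D • (Xf k * Zf k) + E • (Yf k * Zf k) + F • (Zf k) ^ 2)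

/-- The algebra `T(a,b,c,d,e,f; A,B,C,D,E,F)`. -/
abbrev Talg (k : Type*) [Field k] (a b c d e f A B C D E F : k) :=
  RingQuot (Trel k a b c d e f A B C D E F)

/-- The image of `x` in `T`. -/
def Tx (k : Type*) [Field k] (a b c d e f A B C D E F : k) :
    Talg k a b c d e f A B C D E F :=
  RingQuot.mkAlgHom k (Trel k a b c d e f A B C D E F) (Xf k)

/-- The image of `y` in `T`. -/
def Ty (k : Type*) [Field k] (a b c d e f A B C D E F : k) :
    Talg k a b c d e f A B C D E F :=
  RingQuot.mkAlgHom k (Trel k a b c d e f A B C D E F) (Yf k)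

/-- The image of `z` in `T`. -/
def Tz (k : Type*) [Field k] (a b c d e f A B C D E F : k) :
    Talg k a b c d e f A B C D E F :=
  RingQuot.mkAlgHom k (Trel k a b c d e f A B C D E F) (Zf k)

/-- The property that the family `(i,j,l) ↦ y^i x^j z^l` is a `k`-vector-space basis of `T`;
following the paper, this is exactly the condition that `T` is a graded twisted tensor
product of `k[x,y]` and `k[z]`. -/
def ThasBasis (k : Type*) [Field k] (a b c d e f A B C D E F : k) : Prop :=
  LinearIndependent k
      (fun p : ℕ × ℕ × ℕ =>
        (Ty k a b c d e f A B C D E F) ^ p.1 * (Tx k a b c d e f A B C D E F) ^ p.2.1 *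
          (Tz k a b c d e f A B C D E F) ^ p.2.2) ∧
    Submodule.span k
      (Set.range fun p : ℕ × ℕ × ℕ =>
        (Ty k a b c d e f A B C D E F) ^ p.1 * (Tx k a b c d e f A B C D E F) ^ p.2.1 *
          (Tz k a b c d e f A B C D E F) ^ p.2.2) = ⊤

/-- The pair of sequences `(e_n, f_n)` associated to parameters `a, d`. -/
def efPair {k : Type*} [Field k] (a d : k) : ℕ → k × k
  | 0 => (1, 1)
  | n + 1 => (d * (efPair a d n).1 + (efPair a d n).2,
              -a * (efPair a d n).1 + (efPair a d n).2)

/-- The sequence `f_n(a,d)`. -/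
def fSeq {k : Type*} [Field k] (a d : k) (n : ℕ) : k := (efPair a d n).2

/-- If `t * y ∈ y * A` for all `t` in a set, the same holds on the subalgebra it generates. -/
lemma exists_mul_eq_of_adjoin {k A : Type*} [CommSemiring k] [Semiring A] [Algebra k A]
    {S : Set A} {y : A} (hS : ∀ t ∈ S, ∃ s, t * y = y * s) {t : A}
    (ht : t ∈ Algebra.adjoin k S) : ∃ s, t * y = y * s := by
  induction ht using Algebra.adjoin_induction with
  | mem t ht => exact hS t ht
  | algebraMap r => exact ⟨algebraMap k A r, Algebra.commutes r y⟩
  | add t u _ _ ht hu =>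
    obtain ⟨s, hs⟩ := ht
    obtain ⟨v, hv⟩ := hu
    exact ⟨s + v, by rw [add_mul, mul_add, hs, hv]⟩
  | mul t u _ _ ht hu =>
    obtain ⟨s, hs⟩ := ht
    obtain ⟨v, hv⟩ := hu
    exact ⟨s * v, by rw [mul_assoc, hv, ← mul_assoc, hs, mul_assoc]⟩

/-- If `y * t ∈ A * y` for all `t` in a set, the same holds on the subalgebra it generates. -/
lemma exists_eq_mul_of_adjoin {k A : Type*} [CommSemiring k] [Semiring A] [Algebra k A]
    {S : Set A} {y : A} (hS : ∀ t ∈ S, ∃ s, y * t = s * y) {t : A}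
    (ht : t ∈ Algebra.adjoin k S) : ∃ s, y * t = s * y := by
  induction ht using Algebra.adjoin_induction with
  | mem t ht => exact hS t ht
  | algebraMap r => exact ⟨algebraMap k A r, (Algebra.commutes r y).symm⟩
  | add t u _ _ ht hu =>
    obtain ⟨s, hs⟩ := ht
    obtain ⟨v, hv⟩ := hu
    exact ⟨s + v, by rw [add_mul, mul_add, hs, hv]⟩
  | mul t u _ _ ht hu =>
    obtain ⟨s, hs⟩ := ht
    obtain ⟨v, hv⟩ := hu
    exact ⟨s * v, by rw [← mul_assoc, hs, mul_assoc, hv, ← mul_assoc]⟩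

section Relations

variable {k : Type*} [Field k] (a b c d e f A B C D E F : k)

lemma Tx_mul_Ty : Tx k a b c d e f A B C D E F * Ty k a b c d e f A B C D E F =
    Ty k a b c d e f A B C D E F * Tx k a b c d e f A B C D E F := by
  simpa only [Tx, Ty, map_mul] using RingQuot.mkAlgHom_rel k
    (s := Trel k a b c d e f A B C D E F) (Or.inl ⟨rfl, rfl⟩)

lemma Tz_mul_Tx : Tz k a b c d e f A B C D E F * Tx k a b c d e f A B C D E F =
    a • Tx k a b c d e f A B C D E F ^ 2 +
    b • (Tx k a b c d e f A B C D E F * Ty k a b c d e f A B C D E F) +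
    c • Ty k a b c d e f A B C D E F ^ 2 +
    d • (Tx k a b c d e f A B C D E F * Tz k a b c d e f A B C D E F) +
    e • (Ty k a b c d e f A B C D E F * Tz k a b c d e f A B C D E F) +
    f • Tz k a b c d e f A B C D E F ^ 2 := by
  simpa only [Tx, Ty, Tz, map_mul, map_add, map_smul, map_pow] using RingQuot.mkAlgHom_rel k
    (s := Trel k a b c d e f A B C D E F) (Or.inr (Or.inl ⟨rfl, rfl⟩))

lemma Tz_mul_Ty : Tz k a b c d e f A B C D E F * Ty k a b c d e f A B C D E F =
    A • Tx k a b c d e f A B C D E F ^ 2 +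
    B • (Tx k a b c d e f A B C D E F * Ty k a b c d e f A B C D E F) +
    C • Ty k a b c d e f A B C D E F ^ 2 +
    D • (Tx k a b c d e f A B C D E F * Tz k a b c d e f A B C D E F) +
    E • (Ty k a b c d e f A B C D E F * Tz k a b c d e f A B C D E F) +
    F • Tz k a b c d e f A B C D E F ^ 2 := by
  simpa only [Tx, Ty, Tz, map_mul, map_add, map_smul, map_pow] using RingQuot.mkAlgHom_rel k
    (s := Trel k a b c d e f A B C D E F) (Or.inr (Or.inr ⟨rfl, rfl⟩))

lemma adjoin_generators_eq_top :
    Algebra.adjoin k {Tx k a b c d e f A B C D E F, Ty k a b c d e f A B C D E F,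
      Tz k a b c d e f A B C D E F} = ⊤ := by
  have h := congrArg (Subalgebra.map (RingQuot.mkAlgHom k (Trel k a b c d e f A B C D E F)))
    (FreeAlgebra.adjoin_range_ι k (Fin 3))
  rw [AlgHom.map_adjoin, Algebra.map_top,
    (AlgHom.range_eq_top _).2 (RingQuot.mkAlgHom_surjective k _), ← Set.range_comp] at h
  rw [← h]
  congr 1
  ext t
  simp [Fin.exists_fin_succ, Tx, Ty, Tz, Xf, Yf, Zf, eq_comm]

end Relations

/-- Modulo the right ideal `x * A + y * A`, the element `f_n z^(n+1) x` equals `e_n z^(n+2)`. -/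
lemma exists_snd_smul_pow_mul_eq {k A : Type*} [Field k] [Ring A] [Algebra k A]
    {a b c d e : k} {x y z : A} (hxy : x * y = y * x)
    (hzx : z * x = a • x ^ 2 + b • (x * y) + c • y ^ 2 + d • (x * z) + e • (y * z) + z ^ 2)
    (hy : ∀ t, ∃ s, t * y = y * s) (n : ℕ) :
    ∃ p q, (efPair a d n).2 • (z ^ (n + 1) * x) =
      (efPair a d n).1 • z ^ (n + 2) + x * p + y * q := by
  induction n with
  | zero =>
    refine ⟨a • x + b • y + d • z, c • y + e • z, ?_⟩
    simp only [efPair, zero_add, pow_one, hzx, mul_add, mul_smul_comm, pow_two, one_smul]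
    abel
  | succ n ih =>
    obtain ⟨p, q, h⟩ := ih
    obtain ⟨s, hs⟩ := hy (z ^ (n + 1))
    set E := (efPair a d n).1
    set F := (efPair a d n).2
    have hx : F • (z ^ (n + 1) * x ^ 2) = E • (z ^ (n + 2) * x) + x * (p * x) + y * (q * x) := by
      rw [pow_two, ← mul_assoc, ← smul_mul_assoc, h]
      simp only [add_mul, smul_mul_assoc, mul_assoc]
    have hz : F • (z ^ (n + 1) * (x * z)) = E • z ^ (n + 3) + x * (p * z) + y * (q * z) := by
      rw [← mul_assoc, ← smul_mul_assoc, h]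
      simp only [add_mul, smul_mul_assoc, mul_assoc, pow_succ]
    have hzzx : z ^ (n + 2) * x = a • (z ^ (n + 1) * x ^ 2) + b • (y * (s * x)) +
        c • (y * (s * y)) + d • (z ^ (n + 1) * (x * z)) + e • (y * (s * z)) + z ^ (n + 3) := by
      rw [pow_succ z (n + 1), mul_assoc, hzx, hxy]
      simp only [mul_add, mul_smul_comm, ← mul_assoc, ← hs, pow_two y]
      rw [pow_add z (n + 1) 2]
    refine ⟨a • (p * x) + d • (p * z), a • (q * x) + d • (q * z) +
      F • (b • (s * x) + c • (s * y) + e • (s * z)), ?_⟩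
    have key : F • (z ^ (n + 2) * x) = a • (F • (z ^ (n + 1) * x ^ 2)) +
        d • (F • (z ^ (n + 1) * (x * z))) + F • (b • (y * (s * x)) +
        c • (y * (s * y)) + e • (y * (s * z)) + z ^ (n + 3)) := by
      rw [hzzx]
      module
    rw [hx, hz] at key
    simp only [efPair, add_smul, neg_mul, neg_smul, mul_add, mul_smul_comm]
    change -((a * E) • (z ^ (n + 2) * x)) + F • (z ^ (n + 2) * x) = _
    rw [key]
    module

/-- The sequences `e_n` and `f_n` have no common zero, unless `a = 1` and `d = -1`. -/
lemma eq_one_of_efPair_eq_zero {k : Type*} [Field k] {a d : k} {n : ℕ}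
    (h : efPair a d n = 0) : a = 1 ∧ d = -1 := by
  by_cases had : a + d = 0
  · have hpow : ∀ m, efPair a d m = ((1 - a) ^ m, (1 - a) ^ m) := by
      intro m
      induction m with
      | zero => simp [efPair]
      | succ m ih =>
        rw [efPair, ih, eq_neg_of_add_eq_zero_right had]
        ext <;> dsimp only <;> ring
    have h1 : (1 - a) ^ n = 0 := by simpa [hpow] using h
    have ha : a = 1 := (sub_eq_zero.1 (eq_zero_of_pow_eq_zero h1)).symm
    subst ha
    exact ⟨rfl, eq_neg_of_add_eq_zero_right had⟩
  · exfalso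
    induction n with
    | zero => simp [efPair] at h
    | succ n ih =>
      apply ih
      have h1 : d * (efPair a d n).1 + (efPair a d n).2 = 0 := congrArg Prod.fst h
      have h2 : -a * (efPair a d n).1 + (efPair a d n).2 = 0 := congrArg Prod.snd h
      have h3 : (efPair a d n).1 = 0 :=
        (mul_eq_zero.1 (by linear_combination h1 - h2 :
          (a + d) * (efPair a d n).1 = 0)).resolve_left had
      rw [h3, mul_zero, zero_add] at h1
      exact Prod.ext h3 h1

/-- If `(x - z)² = 0` modulo `y`, then the monomials `y^i x^j z^l` do not span: a representation
by `4 × 4` matrices separates `z² x` from them. -/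
lemma span_monomials_ne_top {k : Type*} [Field k] (b c e B C E : k) :
    Submodule.span k (Set.range fun p : ℕ × ℕ × ℕ =>
      Ty k 1 b c (-1) e 1 0 B C 0 E 0 ^ p.1 * Tx k 1 b c (-1) e 1 0 B C 0 E 0 ^ p.2.1 *
        Tz k 1 b c (-1) e 1 0 B C 0 E 0 ^ p.2.2) ≠ ⊤ := by
  intro hspan
  let X : Matrix (Fin 4) (Fin 4) k := !![0, 0, 0, 0; 0, 0, 1, 0; 0, 0, 0, 1; 0, 0, 0, 0]
  let Z : Matrix (Fin 4) (Fin 4) k := !![0, -1, 0, 0; 0, 0, 1, 0; 0, 0, 0, 0; 0, 0, 0, 0]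
  have hZX : Z * X = X ^ 2 + (-1 : k) • (X * Z) + Z ^ 2 := by
    ext i j
    fin_cases i <;> fin_cases j <;> simp [X, Z, pow_two]
  have hZ3 : Z ^ 3 = 0 := by
    ext i j
    fin_cases i <;> fin_cases j <;> simp [Z, pow_succ]
  let ρ₀ : FreeAlgebra k (Fin 3) →ₐ[k] Matrix (Fin 4) (Fin 4) k := FreeAlgebra.lift k ![X, 0, Z]
  have hX₀ : ρ₀ (Xf k) = X := by simp [ρ₀, Xf]
  have hY₀ : ρ₀ (Yf k) = 0 := by simp [ρ₀, Yf]
  have hZ₀ : ρ₀ (Zf k) = Z := by simp [ρ₀, Zf]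
  let ρ : Talg k 1 b c (-1) e 1 0 B C 0 E 0 →ₐ[k] Matrix (Fin 4) (Fin 4) k :=
    RingQuot.liftAlgHom k ⟨ρ₀, by
      rintro _ _ (⟨rfl, rfl⟩ | ⟨rfl, rfl⟩ | ⟨rfl, rfl⟩) <;>
        simp [hX₀, hY₀, hZ₀, hZX]⟩
  have hX : ρ (Tx k 1 b c (-1) e 1 0 B C 0 E 0) = X := by
    simp [ρ, Tx, RingQuot.liftAlgHom_mkAlgHom_apply, hX₀]
  have hY : ρ (Ty k 1 b c (-1) e 1 0 B C 0 E 0) = 0 := by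
    simp [ρ, Ty, RingQuot.liftAlgHom_mkAlgHom_apply, hY₀]
  have hZ : ρ (Tz k 1 b c (-1) e 1 0 B C 0 E 0) = Z := by
    simp [ρ, Tz, RingQuot.liftAlgHom_mkAlgHom_apply, hZ₀]
  let φ : Talg k 1 b c (-1) e 1 0 B C 0 E 0 →ₗ[k] k :=
    Matrix.entryLinearMap k k 0 3 ∘ₗ ρ.toLinearMap
  have hφ : φ = 0 := by
    refine LinearMap.ext_on_range hspan ?_
    rintro ⟨i, j, l⟩
    simp only [φ, LinearMap.comp_apply, AlgHom.toLinearMap_apply, map_mul, map_pow, hX, hY, hZ,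
      LinearMap.zero_apply, Matrix.entryLinearMap_apply]
    rcases i with _ | i
    · rcases j with _ | j
      · rcases l with _ | _ | _ | l
        · simp
        · simp [Z]
        · simp [Z, pow_two]
        · simp [add_assoc, pow_add Z l, hZ3]
      · rw [pow_zero, one_mul, pow_succ', mul_assoc, Matrix.mul_apply]
        simp [X, Fin.sum_univ_succ]
    · simp
  have h := LinearMap.congr_fun hφ
    (Tz k 1 b c (-1) e 1 0 B C 0 E 0 ^ 2 * Tx k 1 b c (-1) e 1 0 B C 0 E 0)
  simp [φ, hX, hZ, X, Z, pow_two] at h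

/-- If the monomials `y^i x^j z^l` form a basis, no nonzero multiple of a power of `z` lies in
the right ideal `x * T + y * T`. -/
lemma eq_zero_of_smul_pow_eq {k A : Type*} [Field k] [Ring A] [Algebra k A] {x y z : A}
    (hxy : x * y = y * x)
    (hli : LinearIndependent k (fun p : ℕ × ℕ × ℕ => y ^ p.1 * x ^ p.2.1 * z ^ p.2.2))
    (hsp : Submodule.span k
      (Set.range fun p : ℕ × ℕ × ℕ => y ^ p.1 * x ^ p.2.1 * z ^ p.2.2) = ⊤)
    {r : k} {l : ℕ} {p q : A} (h : r • z ^ l + x * p + y * q = 0) : r = 0 := by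
  let β := Module.Basis.mk hli hsp.ge
  have hβ : ∀ i j m, y ^ i * x ^ j * z ^ m = β (i, j, m) := fun i j m => by simp [β]
  have hx : β.coord (0, 0, l) ∘ₗ LinearMap.mulLeft k x = 0 := by
    refine β.ext ?_
    rintro ⟨i, j, m⟩
    have : x * (y ^ i * x ^ j * z ^ m) = y ^ i * x ^ (j + 1) * z ^ m := by
      rw [← mul_assoc, ← mul_assoc, ((show Commute x y from hxy).pow_right i).eq, mul_assoc (y ^ i),
        ← pow_succ']
    rw [LinearMap.comp_apply, LinearMap.mulLeft_apply, ← hβ, this, hβ]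
    simp
  have hy : β.coord (0, 0, l) ∘ₗ LinearMap.mulLeft k y = 0 := by
    refine β.ext ?_
    rintro ⟨i, j, m⟩
    have : y * (y ^ i * x ^ j * z ^ m) = y ^ (i + 1) * x ^ j * z ^ m := by
      rw [← mul_assoc, ← mul_assoc, ← pow_succ']
    rw [LinearMap.comp_apply, LinearMap.mulLeft_apply, ← hβ, this, hβ]
    simp
  have hz : z ^ l = β (0, 0, l) := by rw [← hβ, pow_zero, pow_zero, one_mul, one_mul]
  have hp : β.coord (0, 0, l) (x * p) = 0 := LinearMap.congr_fun hx p
  have hq : β.coord (0, 0, l) (y * q) = 0 := LinearMap.congr_fun hy q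
  have h' := congrArg (β.coord (0, 0, l)) h
  rw [map_add, map_add, hp, hq, hz] at h'
  simpa using h'

/-- If `T = T(a,b,c,d,e,1; 0,B,C,0,E,0)` with `E ≠ 0` and the family
`(i,j,l) ↦ y^i x^j z^l` is a `k`-basis of `T`, then `y` is normal in `T`, `f_n(a,d) ≠ 0`
for all `n ≥ 1`, and in particular `a ≠ 1`. -/
theorem stmt11 {k : Type*} [Field k] [IsAlgClosed k] (a b c d e B C E : k) (hE : E ≠ 0)
    (hbasis : ThasBasis k a b c d e 1 0 B C 0 E 0) :
    (Set.range (fun t : Talg k a b c d e 1 0 B C 0 E 0 => Ty k a b c d e 1 0 B C 0 E 0 * t) =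
      Set.range (fun t : Talg k a b c d e 1 0 B C 0 E 0 => t * Ty k a b c d e 1 0 B C 0 E 0)) ∧
    (∀ n : ℕ, 1 ≤ n → fSeq a d n ≠ 0) ∧ a ≠ 1 := by
  obtain ⟨hli, hsp⟩ := hbasis
  have hxy := Tx_mul_Ty a b c d e 1 0 B C 0 E 0
  have hzx := Tz_mul_Tx a b c d e 1 0 B C 0 E 0
  have hzy := Tz_mul_Ty a b c d e 1 0 B C 0 E 0
  have htop := adjoin_generators_eq_top a b c d e 1 0 B C 0 E 0
  have hne : ¬(a = 1 ∧ d = -1) := by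
    rintro ⟨rfl, rfl⟩
    exact span_monomials_ne_top b c e B C E hsp
  simp only [zero_smul, zero_add, add_zero, one_smul] at hzx hzy
  generalize Tx k a b c d e 1 0 B C 0 E 0 = x at *
  generalize Ty k a b c d e 1 0 B C 0 E 0 = y at *
  generalize Tz k a b c d e 1 0 B C 0 E 0 = z at *
  have hleft : ∀ t, ∃ s, t * y = y * s := fun t => by
    refine exists_mul_eq_of_adjoin (k := k) (S := {x, y, z}) ?_ (htop ▸ Algebra.mem_top)
    simp only [Set.mem_insert_iff, Set.mem_singleton_iff, forall_eq_or_imp, forall_eq]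
    exact ⟨⟨_, hxy⟩, ⟨_, rfl⟩, B • x + C • y + E • z, by
      simp only [hzy, hxy, pow_two, mul_add, mul_smul_comm]⟩
  have hright : ∀ t, ∃ s, y * t = s * y := fun t => by
    refine exists_eq_mul_of_adjoin (k := k) (S := {x, y, z}) ?_ (htop ▸ Algebra.mem_top)
    simp only [Set.mem_insert_iff, Set.mem_singleton_iff, forall_eq_or_imp, forall_eq]
    refine ⟨⟨_, hxy.symm⟩, ⟨_, rfl⟩, E⁻¹ • (z - B • x - C • y), ?_⟩
    rw [eq_comm, smul_mul_assoc, inv_smul_eq_iff₀ hE, sub_mul, sub_mul, hzy, smul_mul_assoc,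
      smul_mul_assoc, pow_two]
    abel
  have hf : ∀ n, fSeq a d n ≠ 0 := by
    intro n hn
    obtain ⟨p, q, h⟩ := exists_snd_smul_pow_mul_eq hxy hzx hleft n
    rw [show (efPair a d n).2 = 0 from hn, zero_smul] at h
    exact hne (eq_one_of_efPair_eq_zero
      (Prod.ext (eq_zero_of_smul_pow_eq hxy hli hsp h.symm) hn))
  refine ⟨Set.Subset.antisymm ?_ ?_, fun n _ => hf n, ?_⟩
  · rintro _ ⟨t, rfl⟩
    obtain ⟨s, hs⟩ := hright t
    exact ⟨s, hs.symm⟩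
  · rintro _ ⟨t, rfl⟩
    obtain ⟨s, hs⟩ := hleft t
    exact ⟨s, hs.symm⟩
  · rintro rfl
    exact hf 1 (by simp [fSeq, efPair])
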